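/- Let H be a complex Hilbert space and M a von Neumann algebra on H. Let S and T be elements of M with 0 ≤ S ≤ T in the operator order. Then there exists an element D of M with operator norm ‖D‖ ≤ 1 such that D · T^{1/2} = S^{1/2}, where T^{1/2} and S^{1/2} denote the positive square roots given by the continuous functional calculus. -/

import Mathlib

set_option synthInstance.maxHeartbeats 1000000
set_option maxHeartbeats 1000000

noncomputable section

theorem sqrt_apply_inner_aux {H : Type*} [NormedAddCommGroup H] [InnerProductSpace ℂ H]
    [CompleteSpace H] (S : H →L[ℂ] H) (hS : 0 ≤ S) (x : H) :
    (‖CFC.sqrt S x‖ : ℝ) ^ 2 = S.reApplyInnerSelf x := by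
  have hsa : IsSelfAdjoint (CFC.sqrt S) := (CFC.sqrt_nonneg S).isSelfAdjoint
  have hsym := hsa.isSymmetric
  have h1 : CFC.sqrt S (CFC.sqrt S x) = S x := by
    have := CFC.sqrt_mul_sqrt_self S hS
    exact congrArg (fun f : H →L[ℂ] H => f x) this
  rw [ContinuousLinearMap.reApplyInnerSelf_apply, ← h1]
  have h2 : inner ℂ (CFC.sqrt S (CFC.sqrt S x)) x = inner ℂ (CFC.sqrt S x) (CFC.sqrt S x) :=
    hsym _ _
  rw [h2]
  exact norm_sq_eq_re_inner (𝕜 := ℂ) _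

theorem norm_sqrt_le_aux {H : Type*} [NormedAddCommGroup H] [InnerProductSpace ℂ H]
    [CompleteSpace H] (S T : H →L[ℂ] H) (hS : 0 ≤ S) (hST : S ≤ T) (x : H) :
    ‖CFC.sqrt S x‖ ≤ ‖CFC.sqrt T x‖ := by
  refine (sq_le_sq₀ (norm_nonneg _) (norm_nonneg _)).1 ?_
  rw [sqrt_apply_inner_aux S hS, sqrt_apply_inner_aux T (hS.trans hST)]
  have h := ((ContinuousLinearMap.le_def S T).1 hST).re_inner_nonneg_left x
  simp only [ContinuousLinearMap.sub_apply, inner_sub_left, map_sub] at h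
  simp only [ContinuousLinearMap.reApplyInnerSelf_apply]
  linarith

/-- Douglas factorization with control on the kernel. -/
theorem douglas_aux {H : Type*} [NormedAddCommGroup H] [InnerProductSpace ℂ H]
    [CompleteSpace H] (A B : H →L[ℂ] H) (hA : IsSelfAdjoint A)
    (hAB : ∀ x, ‖B x‖ ≤ ‖A x‖) :
    ∃ D : H →L[ℂ] H, ‖D‖ ≤ 1 ∧ D * A = B ∧
      ∀ y : H →L[ℂ] H, Commute A y → Commute B y → Commute D y := by
  let K : Submodule ℂ H := A.range.topologicalClosure
  have hK : IsClosed (K : Set H) := Submodule.isClosed_topologicalClosure _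
  have : CompleteSpace K := hK.completeSpace_coe
  have hAK : ∀ x, A x ∈ K := fun x => Submodule.le_topologicalClosure _ ⟨x, rfl⟩
  let e : H →ₗ[ℂ] K := (A : H →ₗ[ℂ] H).codRestrict K hAK
  have hcl : ∀ k : K, (k : H) ∈ closure (Set.range A) := by
    rintro ⟨k, hk⟩
    exact hk
  have he : DenseRange e := by
    intro k
    rw [Topology.IsInducing.subtypeVal.closure_eq_preimage_closure_image, ← Set.range_comp]
    exact hcl k
  have hn : ∀ x, ‖(B : H →ₗ[ℂ] H) x‖ ≤ 1 * ‖e x‖ := by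
    intro x
    rw [one_mul]
    exact hAB x
  let E : K →L[ℂ] H := (B : H →ₗ[ℂ] H).extendOfNorm e
  let D : H →L[ℂ] H := E ∘L K.orthogonalProjectionOnto
  have hEn : ‖E‖ ≤ 1 := LinearMap.opNorm_extendOfNorm_le he zero_le_one hn
  have hDA : ∀ x, D (A x) = B x := by
    intro x
    have h1 : K.orthogonalProjectionOnto (A x) = e x :=
      Submodule.orthogonalProjectionOnto_mem_subspace_eq_self (e x)
    change E (K.orthogonalProjectionOnto (A x)) = B x
    rw [h1]
    exact LinearMap.extendOfNorm_eq he ⟨1, hn⟩ x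
  have hperp : ∀ x, x ∈ Kᗮ ↔ A x = 0 := by
    intro x
    have : Kᗮ = A.ker := by
      rw [Submodule.orthogonal_closure, ContinuousLinearMap.orthogonal_range]
      rw [← ContinuousLinearMap.star_eq_adjoint, hA.star_eq]
    rw [this]; rfl
  have hD0 : ∀ x, A x = 0 → D x = 0 := by
    intro x hx
    change E (K.orthogonalProjectionOnto x) = 0
    rw [Submodule.orthogonalProjectionOnto_apply_of_mem_orthogonal ((hperp x).2 hx),
      map_zero]
  refine ⟨D, ?_, ?_, ?_⟩
  · calc ‖D‖ ≤ ‖E‖ * ‖K.orthogonalProjectionOnto‖ := E.opNorm_comp_le _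
      _ ≤ 1 * 1 := by
        gcongr
        exact K.orthogonalProjectionOnto_norm_le
      _ = 1 := one_mul 1
  · ext x
    exact hDA x
  · intro y hAy hBy
    have hAy' : ∀ x, A (y x) = y (A x) := fun x => congrArg (fun f : H →L[ℂ] H => f x) hAy.eq
    have hBy' : ∀ x, B (y x) = y (B x) := fun x => congrArg (fun f : H →L[ℂ] H => f x) hBy.eq
    have hk : ∀ k : K, D (y k) = y (D k) := by
      intro k
      have hc : IsClosed {x : H | D (y x) = y (D x)} := isClosed_eq (by fun_prop) (by fun_prop)
      refine closure_minimal ?_ hc (hcl k)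
      rintro _ ⟨z, rfl⟩
      change D (y (A z)) = y (D (A z))
      rw [← hAy', hDA, hDA, hBy']
    ext x
    change D (y x) = y (D x)
    set p : K := K.orthogonalProjectionOnto x with hp
    have hq : A (x - p) = 0 := (hperp _).1 (K.sub_starProjection_mem_orthogonal x)
    have hx : x = p + (x - p) := by abel
    rw [hx, map_add, map_add, map_add, map_add, hk, hD0 _ hq,
      hD0 (y (x - p)) (by rw [hAy', hq, map_zero]), map_zero]

/-- **Douglas' lemma in a von Neumann algebra.**
If `M` is a von Neumann algebra on a complex Hilbert space `H` and `S, T ∈ M`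
satisfy `0 ≤ S ≤ T` in the Loewner order, then there is a contraction `D ∈ M`
with `D * T^{1/2} = S^{1/2}`, where the square roots are the positive square
roots given by the continuous functional calculus. -/
theorem exists_contraction_mem_vonNeumannAlgebra_mul_sqrt_eq_sqrt
    {H : Type*} [NormedAddCommGroup H] [InnerProductSpace ℂ H] [CompleteSpace H]
    (M : VonNeumannAlgebra H) (S T : H →L[ℂ] H)
    (hSM : S ∈ M) (hTM : T ∈ M)
    (hS : 0 ≤ S) (hST : S ≤ T) :
    ∃ D : H →L[ℂ] H, D ∈ M ∧ ‖D‖ ≤ 1 ∧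
      D * CFC.sqrt T = CFC.sqrt S := by
  obtain ⟨D, hD1, hDA, hDc⟩ := douglas_aux (CFC.sqrt T) (CFC.sqrt S)
    (CFC.sqrt_nonneg T).isSelfAdjoint (norm_sqrt_le_aux S T hS hST)
  refine ⟨D, ?_, hD1, hDA⟩
  rw [← M.commutant_commutant, VonNeumannAlgebra.mem_commutant_iff]
  intro y hy
  rw [VonNeumannAlgebra.mem_commutant_iff] at hy
  have hT : Commute T y := hy T hTM
  have hS' : Commute S y := hy S hSM
  exact (hDc y (hT.cfcₙ_nnreal _) (hS'.cfcₙ_nnreal _)).symm.eq
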